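/- If c₂ ≠ 0, then the interior CMC slice is defined for all sufficiently small r > 0 and the interior Hawking mass blows up at the Schwarzschild singularity at rate r^(−3): lim_{r→0⁺} r³·m_H(r) = −c₂²/2. -/

import Mathlib

open Real Filter Topology Set

/-- Schwarzschild lapse-type function `f(r) = 1 - 2M/r` (negative in the interior
`0 < r < 2M`). -/
noncomputable def f (M r : ℝ) : ℝ := 1 - 2 * M / r

/-- `P(r) = Ĥ·r + c₂/r²`. -/
noncomputable def P (H c2 r : ℝ) : ℝ := H * r + c2 / r ^ 2

/-- Slope of the interior CMC slice:
`𝔥'(r) = |P(r)|/((2M/r − 1)·√(P(r)² + f(r)))`, defined on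
`{0 < r < 2M : P(r)² + f(r) > 0}`. -/
noncomputable def hInt' (M H c2 r : ℝ) : ℝ :=
  |P H c2 r| / ((2 * M / r - 1) * Real.sqrt ((P H c2 r) ^ 2 + f M r))

/-- Interior Hawking mass `m_H(r) = (r/2)(1 − (f⁻¹ − f 𝔥'²)⁻¹)`. -/
noncomputable def mHint (M H c2 r : ℝ) : ℝ :=
  r / 2 * (1 - ((f M r)⁻¹ - f M r * (hInt' M H c2 r) ^ 2)⁻¹)

/-- If `c₂ ≠ 0`, then the interior CMC slice is defined for all sufficiently small
`r > 0` and the interior Hawking mass blows up at the Schwarzschild singularity at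
rate `r^(−3)`: `lim_{r→0⁺} r³·m_H(r) = −c₂²/2`. -/
theorem interior_hawking_blowup (M H c2 : ℝ) (hM : 0 < M) (hc : c2 ≠ 0) :
    (∀ᶠ r in 𝓝[>] (0 : ℝ), r < 2 * M ∧ 0 < (P H c2 r) ^ 2 + f M r) ∧
    Tendsto (fun r => r ^ 3 * mHint M H c2 r) (𝓝[>] (0 : ℝ)) (𝓝 (-c2 ^ 2 / 2)) := by
  have key : ∀ᶠ r in 𝓝[>] (0 : ℝ), 0 < r ∧ r < 2 * M ∧ 0 < (P H c2 r) ^ 2 + f M r := by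
    have hcont : Tendsto (fun r : ℝ => (H * r ^ 3 + c2) ^ 2 + r ^ 4 - 2 * M * r ^ 3)
        (𝓝[>] (0 : ℝ)) (𝓝 (c2 ^ 2)) := by
      have h : Continuous (fun r : ℝ => (H * r ^ 3 + c2) ^ 2 + r ^ 4 - 2 * M * r ^ 3) := by
        fun_prop
      have h0 := h.tendsto 0
      simp only [ne_eq, OfNat.ofNat_ne_zero, not_false_eq_true, zero_pow, mul_zero, zero_add,
        add_zero, sub_zero] at h0
      exact h0.mono_left nhdsWithin_le_nhds
    have hpos : (0 : ℝ) < c2 ^ 2 := by positivity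
    have h2M : ∀ᶠ r in 𝓝[>] (0 : ℝ), r < 2 * M :=
      nhdsWithin_le_nhds (Iio_mem_nhds (by positivity))
    filter_upwards [self_mem_nhdsWithin, h2M, hcont.eventually_const_lt hpos] with r hr h2 h3
    have hr' : 0 < r := hr
    refine ⟨hr', h2, ?_⟩
    have e : (P H c2 r) ^ 2 + f M r
        = ((H * r ^ 3 + c2) ^ 2 + r ^ 4 - 2 * M * r ^ 3) / r ^ 4 := by
      unfold P f
      field_simp
      ring
    rw [e]
    positivity
  refine ⟨key.mono fun r h => h.2, ?_⟩
  have hlim : Tendsto (fun r : ℝ => M * r ^ 3 - (H * r ^ 3 + c2) ^ 2 / 2)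
      (𝓝[>] (0 : ℝ)) (𝓝 (-c2 ^ 2 / 2)) := by
    have h : Continuous (fun r : ℝ => M * r ^ 3 - (H * r ^ 3 + c2) ^ 2 / 2) := by
      fun_prop
    have h0 := h.tendsto 0
    have e : M * (0 : ℝ) ^ 3 - (H * 0 ^ 3 + c2) ^ 2 / 2 = -c2 ^ 2 / 2 := by ring
    rw [e] at h0
    exact h0.mono_left nhdsWithin_le_nhds
  refine hlim.congr' ?_
  filter_upwards [key] with r hr
  obtain ⟨hr, h2, h3⟩ := hr
  have hf : f M r < 0 := by
    unfold f
    have : 1 < 2 * M / r := by rwa [one_lt_div hr]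
    linarith
  have hfe : 2 * M / r - 1 = - f M r := by unfold f; ring
  have hh : (hInt' M H c2 r) ^ 2
      = (P H c2 r) ^ 2 / ((f M r) ^ 2 * ((P H c2 r) ^ 2 + f M r)) := by
    unfold hInt'
    rw [hfe, div_pow, mul_pow, Real.sq_sqrt h3.le, sq_abs, neg_sq]
  have hinv : (f M r)⁻¹ - f M r * (hInt' M H c2 r) ^ 2 = ((P H c2 r) ^ 2 + f M r)⁻¹ := by
    rw [hh]
    have h1 := hf.ne
    have h4 := h3.ne'
    field_simp
    ring
  unfold mHint
  rw [hinv, inv_inv]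
  unfold P f
  field_simp
  ring
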